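/- Let P(λ) = Σ_{i=0}^k λ^i A_i be an m×n matrix polynomial of grade k with m ≥ n. Parametrize 𝕃₁(P) by pairs (v, W) ∈ F^k × F^{km×(k-1)n} via the bijection sending (v, W) to L(λ) = λ[v⊗A_k −W] + [W + v⊗[A_{k-1} … A_1] v⊗A₀]. Then there exists a polynomial function 𝒫 in the k + k(k−1)mn entries of (v, W), not identically zero, such that every pair (v, W) with 𝒫(v, W) ≠ 0 corresponds to a pencil L(λ) ∈ 𝕃₁(P) of full Z-rank, and hence to a strong g-linearization of P(λ). In particular, almost every pencil in 𝕃₁(P) is a strong g-linearization of P(λ). -/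

import Mathlib

noncomputable section

open Polynomial Matrix

namespace GLin

variable {F : Type*} [RCLike F]

/-! ### Matrix polynomials and pencils -/

/-- The matrix polynomial `P(λ) = ∑_{i=0}^k λ^i A_i` determined by its
coefficient matrices `A_0, …, A_k` (grade `k`). -/
def matPoly {k m n : ℕ} (A : Fin (k + 1) → Matrix (Fin m) (Fin n) F) :
    Matrix (Fin m) (Fin n) F[X] :=
  Matrix.of fun r c => ∑ i : Fin (k + 1), Polynomial.C (A i r c) * Polynomial.X ^ (i : ℕ)

/-- The matrix pencil `L(λ) = λ X + Y`. -/
def pencil {ρ γ : Type*} (Xc Yc : Matrix ρ γ F) : Matrix ρ γ F[X] :=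
  Matrix.of fun i j => Polynomial.C (Xc i j) * Polynomial.X + Polynomial.C (Yc i j)

/-- `Λ_k(λ) ⊗ I_n` where `Λ_k(λ) = (λ^{k-1}, …, λ, 1)ᵀ`. -/
def Lam (F : Type*) [RCLike F] (k n : ℕ) : Matrix (Fin k × Fin n) (Fin n) F[X] :=
  Matrix.of fun p c => if p.2 = c then Polynomial.X ^ (k - 1 - (p.1 : ℕ)) else 0

/-- `Λ_k(λ)ᵀ ⊗ I_m`. -/
def LamRow (F : Type*) [RCLike F] (k m : ℕ) : Matrix (Fin m) (Fin k × Fin m) F[X] :=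
  Matrix.of fun r p => if r = p.2 then Polynomial.X ^ (k - 1 - (p.1 : ℕ)) else 0

/-- `v ⊗ P(λ)`. -/
def vkron {k m n : ℕ} (v : Fin k → F) (P : Matrix (Fin m) (Fin n) F[X]) :
    Matrix (Fin k × Fin m) (Fin n) F[X] :=
  Matrix.of fun p c => Polynomial.C (v p.1) * P p.2 c

/-- `wᵀ ⊗ P(λ)`. -/
def wkron {k m n : ℕ} (w : Fin k → F) (P : Matrix (Fin m) (Fin n) F[X]) :
    Matrix (Fin m) (Fin k × Fin n) F[X] :=
  Matrix.of fun r q => Polynomial.C (w q.1) * P r q.2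

/-- The defining identity of `𝕃₁(P)`: `L(λ)(Λ_k(λ) ⊗ I_n) = v ⊗ P(λ)`. -/
def RightAnsatz {k m n : ℕ} (P : Matrix (Fin m) (Fin n) F[X])
    (L : Matrix (Fin k × Fin m) (Fin k × Fin n) F[X]) (v : Fin k → F) : Prop :=
  L * Lam F k n = vkron v P

/-- The defining identity of `𝕃₂(P)`: `(Λ_k(λ)ᵀ ⊗ I_m) L(λ) = wᵀ ⊗ P(λ)`. -/
def LeftAnsatz {k m n : ℕ} (P : Matrix (Fin m) (Fin n) F[X])
    (L : Matrix (Fin k × Fin m) (Fin k × Fin n) F[X]) (w : Fin k → F) : Prop :=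
  LamRow F k m * L = wkron w P

/-- The vector `α e₁ ∈ F^k`. -/
def e1 {k : ℕ} (α : F) : Fin k → F := fun i => if (i : ℕ) = 0 then α else 0

/-- `M ⊗ I_m`. -/
def kronId {k m : ℕ} (M : Matrix (Fin k) (Fin k) F) :
    Matrix (Fin k × Fin m) (Fin k × Fin m) F :=
  Matrix.of fun p q => if p.2 = q.2 then M p.1 q.1 else 0

/-! ### (strong) g-linearizations -/

/-- `diag(P(λ), I_{k-1} ⊗ I_{m,n})`. -/
def glinTarget {k m n : ℕ} (P : Matrix (Fin m) (Fin n) F[X]) :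
    Matrix (Fin k × Fin m) (Fin k × Fin n) F[X] :=
  Matrix.of fun p q =>
    if p.1 = q.1 then
      (if (p.1 : ℕ) = 0 then P p.2 q.2 else if (p.2 : ℕ) = (q.2 : ℕ) then 1 else 0)
    else 0

/-- A `km × kn` pencil (or matrix polynomial) `L` is a g-linearization of the `m × n`
matrix polynomial `P` of grade `k` if `E(λ) L(λ) G(λ) = diag(P(λ), I_{k-1} ⊗ I_{m,n})`
for unimodular `E`, `G`. -/
def IsGLin {k m n : ℕ} (P : Matrix (Fin m) (Fin n) F[X])
    (L : Matrix (Fin k × Fin m) (Fin k × Fin n) F[X]) : Prop :=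
  ∃ (E : Matrix (Fin k × Fin m) (Fin k × Fin m) F[X])
    (G : Matrix (Fin k × Fin n) (Fin k × Fin n) F[X]),
      IsUnit E.det ∧ IsUnit G.det ∧ E * L * G = glinTarget P

/-- grade-`N` reversal `rev_N P(λ) = λ^N P(1/λ)`, entrywise. -/
def revMat {ρ γ : Type*} (N : ℕ) (P : Matrix ρ γ F[X]) : Matrix ρ γ F[X] :=
  P.map fun p => Polynomial.reflect N p

/-- Strong g-linearization of the grade-`k` matrix polynomial with coefficients `A`. -/
def IsStrongGLin {k m n : ℕ} (A : Fin (k + 1) → Matrix (Fin m) (Fin n) F)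
    (L : Matrix (Fin k × Fin m) (Fin k × Fin n) F[X]) : Prop :=
  IsGLin (matPoly A) L ∧ IsGLin (revMat k (matPoly A)) (revMat 1 L)

/-! ### linearizations (rectangular, of size `(m+s) × (n+s)`) -/

/-- A matrix polynomial `L` (indexed by arbitrary finite types of cardinalities
`m + s` and `n + s`) is a linearization of `P` if, after identifying the index types
with `Fin m ⊕ Fin s` and `Fin n ⊕ Fin s`, one has `E(λ) L(λ) G(λ) = diag(P(λ), I_s)`
for unimodular `E`, `G`. -/
def IsLin {m n : ℕ} (s : ℕ) (P : Matrix (Fin m) (Fin n) F[X])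
    {ρ γ : Type*} [Fintype ρ] [DecidableEq ρ] [Fintype γ] [DecidableEq γ]
    (L : Matrix ρ γ F[X]) : Prop :=
  ∃ (er : ρ ≃ (Fin m ⊕ Fin s)) (ec : γ ≃ (Fin n ⊕ Fin s))
    (E : Matrix (Fin m ⊕ Fin s) (Fin m ⊕ Fin s) F[X])
    (G : Matrix (Fin n ⊕ Fin s) (Fin n ⊕ Fin s) F[X]),
      IsUnit E.det ∧ IsUnit G.det ∧
        E * Matrix.reindex er ec L * G = Matrix.fromBlocks P 0 0 1

/-- Strong linearization of the grade-`k` matrix polynomial with coefficients `A`. -/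
def IsStrongLin {k m n : ℕ} (s : ℕ) (A : Fin (k + 1) → Matrix (Fin m) (Fin n) F)
    {ρ γ : Type*} [Fintype ρ] [DecidableEq ρ] [Fintype γ] [DecidableEq γ]
    (L : Matrix ρ γ F[X]) : Prop :=
  IsLin s (matPoly A) L ∧ IsLin s (revMat k (matPoly A)) (revMat 1 L)

/-! ### shifted sums -/

/-- Column shifted sum `X ⊞→ Y`. -/
def colShiftSum {k m n : ℕ} (Xc Yc : Matrix (Fin k × Fin m) (Fin k × Fin n) F) :
    Matrix (Fin k × Fin m) (Fin (k + 1) × Fin n) F :=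
  Matrix.of fun p q =>
    (if h : (q.1 : ℕ) < k then Xc p (⟨(q.1 : ℕ), h⟩, q.2) else 0) +
    (if h : 0 < (q.1 : ℕ) then
        Yc p (⟨(q.1 : ℕ) - 1, by have := q.1.isLt; omega⟩, q.2)
      else 0)

/-- Row shifted sum `X ⊞↓ Y`. -/
def rowShiftSum {k m n : ℕ} (Xc Yc : Matrix (Fin k × Fin m) (Fin k × Fin n) F) :
    Matrix (Fin (k + 1) × Fin m) (Fin k × Fin n) F :=
  Matrix.of fun p q =>
    (if h : (p.1 : ℕ) < k then Xc (⟨(p.1 : ℕ), h⟩, p.2) q else 0) +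
    (if h : 0 < (p.1 : ℕ) then
        Yc (⟨(p.1 : ℕ) - 1, by have := p.1.isLt; omega⟩, p.2) q
      else 0)

/-! ### the parametrization of `𝕃₁(P)` and `𝕃₂(P)` -/

/-- `X = [v ⊗ A_k ∣ -W]`. -/
def L1X {k m n : ℕ} (A : Fin (k + 1) → Matrix (Fin m) (Fin n) F) (v : Fin k → F)
    (W : Matrix (Fin k × Fin m) (Fin (k - 1) × Fin n) F) :
    Matrix (Fin k × Fin m) (Fin k × Fin n) F :=
  Matrix.of fun p q =>
    if h : (q.1 : ℕ) = 0 then v p.1 * A (Fin.last k) p.2 q.2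
    else -W p (⟨(q.1 : ℕ) - 1, by have := q.1.isLt; omega⟩, q.2)

/-- `Y = [W + v ⊗ [A_{k-1} ⋯ A_1] ∣ v ⊗ A_0]`. -/
def L1Y {k m n : ℕ} (A : Fin (k + 1) → Matrix (Fin m) (Fin n) F) (v : Fin k → F)
    (W : Matrix (Fin k × Fin m) (Fin (k - 1) × Fin n) F) :
    Matrix (Fin k × Fin m) (Fin k × Fin n) F :=
  Matrix.of fun p q =>
    if h : (q.1 : ℕ) < k - 1 then
      W p (⟨(q.1 : ℕ), h⟩, q.2) + v p.1 * A (⟨k - 1 - (q.1 : ℕ), by omega⟩) p.2 q.2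
    else v p.1 * A 0 p.2 q.2

/-- `X = [wᵀ ⊗ A_k ; -Ŵ]`. -/
def L2X {k m n : ℕ} (A : Fin (k + 1) → Matrix (Fin m) (Fin n) F) (w : Fin k → F)
    (W : Matrix (Fin (k - 1) × Fin m) (Fin k × Fin n) F) :
    Matrix (Fin k × Fin m) (Fin k × Fin n) F :=
  Matrix.of fun p q =>
    if h : (p.1 : ℕ) = 0 then w q.1 * A (Fin.last k) p.2 q.2
    else -W (⟨(p.1 : ℕ) - 1, by have := p.1.isLt; omega⟩, p.2) q

/-- `Y = [Ŵ + wᵀ ⊗ [A_{k-1}ᵀ ⋯ A_1ᵀ]ᵀ ; wᵀ ⊗ A_0]`. -/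
def L2Y {k m n : ℕ} (A : Fin (k + 1) → Matrix (Fin m) (Fin n) F) (w : Fin k → F)
    (W : Matrix (Fin (k - 1) × Fin m) (Fin k × Fin n) F) :
    Matrix (Fin k × Fin m) (Fin k × Fin n) F :=
  Matrix.of fun p q =>
    if h : (p.1 : ℕ) < k - 1 then
      W (⟨(p.1 : ℕ), h⟩, p.2) q + w q.1 * A (⟨k - 1 - (p.1 : ℕ), by omega⟩) p.2 q.2
    else w q.1 * A 0 p.2 q.2

/-! ### block structure and `Z`-matrices -/

/-- Assemble a `km × kn` matrix from blocks with row split `m + (k-1)m` and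
column split `n + (k-1)n`. -/
def blk {k m n : ℕ} (TL : Matrix (Fin m) (Fin n) F)
    (TR : Matrix (Fin m) (Fin (k - 1) × Fin n) F)
    (BL : Matrix (Fin (k - 1) × Fin m) (Fin n) F)
    (BR : Matrix (Fin (k - 1) × Fin m) (Fin (k - 1) × Fin n) F) :
    Matrix (Fin k × Fin m) (Fin k × Fin n) F :=
  Matrix.of fun p q =>
    if hp : (p.1 : ℕ) = 0 then
      if hq : (q.1 : ℕ) = 0 then TL p.2 q.2
      else TR p.2 (⟨(q.1 : ℕ) - 1, by have := q.1.isLt; omega⟩, q.2)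
    else
      if hq : (q.1 : ℕ) = 0 then
        BL (⟨(p.1 : ℕ) - 1, by have := p.1.isLt; omega⟩, p.2) q.2
      else
        BR (⟨(p.1 : ℕ) - 1, by have := p.1.isLt; omega⟩, p.2)
          (⟨(q.1 : ℕ) - 1, by have := q.1.isLt; omega⟩, q.2)

/-- Assemble `[[Y₁₁, T],[Z, 0]]`, row split `m + (k-1)m`, column split `(k-1)n + n`. -/
def blkY1 {k m n : ℕ} (Y11 : Matrix (Fin m) (Fin (k - 1) × Fin n) F)
    (T : Matrix (Fin m) (Fin n) F)
    (Z : Matrix (Fin (k - 1) × Fin m) (Fin (k - 1) × Fin n) F) :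
    Matrix (Fin k × Fin m) (Fin k × Fin n) F :=
  Matrix.of fun p q =>
    if hp : (p.1 : ℕ) = 0 then
      if hq : (q.1 : ℕ) < k - 1 then Y11 p.2 (⟨(q.1 : ℕ), hq⟩, q.2) else T p.2 q.2
    else
      if hq : (q.1 : ℕ) < k - 1 then
        Z (⟨(p.1 : ℕ) - 1, by have := p.1.isLt; omega⟩, p.2) (⟨(q.1 : ℕ), hq⟩, q.2)
      else 0

/-- Assemble `[[Y₁₁, Z],[T, 0]]`, row split `(k-1)m + m`, column split `n + (k-1)n`. -/
def blkY2 {k m n : ℕ} (Y11 : Matrix (Fin (k - 1) × Fin m) (Fin n) F)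
    (Z : Matrix (Fin (k - 1) × Fin m) (Fin (k - 1) × Fin n) F)
    (T : Matrix (Fin m) (Fin n) F) :
    Matrix (Fin k × Fin m) (Fin k × Fin n) F :=
  Matrix.of fun p q =>
    if hp : (p.1 : ℕ) < k - 1 then
      if hq : (q.1 : ℕ) = 0 then Y11 (⟨(p.1 : ℕ), hp⟩, p.2) q.2
      else Z (⟨(p.1 : ℕ), hp⟩, p.2) (⟨(q.1 : ℕ) - 1, by have := q.1.isLt; omega⟩, q.2)
    else
      if hq : (q.1 : ℕ) = 0 then T p.2 q.2 else 0

/-- The `Z`-matrix of `L = λX + Y ∈ 𝕃₁(P)` with respect to `M`: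
the lower-left `(k-1)m × (k-1)n` block of `(M ⊗ I_m) Y`. -/
def Zmat1 {k m n : ℕ} (M : Matrix (Fin k) (Fin k) F)
    (Yc : Matrix (Fin k × Fin m) (Fin k × Fin n) F) :
    Matrix (Fin (k - 1) × Fin m) (Fin (k - 1) × Fin n) F :=
  Matrix.of fun p q =>
    (kronId M * Yc : Matrix (Fin k × Fin m) (Fin k × Fin n) F)
      (⟨(p.1 : ℕ) + 1, by have := p.1.isLt; omega⟩, p.2)
      (⟨(q.1 : ℕ), by have := q.1.isLt; omega⟩, q.2)

/-- The `Z`-matrix of `L = λX + Y ∈ 𝕃₂(P)` with respect to `M̂`: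
the upper-right `(k-1)m × (k-1)n` block of `Y (M̂ᵀ ⊗ I_n)`. -/
def Zmat2 {k m n : ℕ} (M : Matrix (Fin k) (Fin k) F)
    (Yc : Matrix (Fin k × Fin m) (Fin k × Fin n) F) :
    Matrix (Fin (k - 1) × Fin m) (Fin (k - 1) × Fin n) F :=
  Matrix.of fun p q =>
    (Yc * kronId Mᵀ : Matrix (Fin k × Fin m) (Fin k × Fin n) F)
      (⟨(p.1 : ℕ), by have := p.1.isLt; omega⟩, p.2)
      (⟨(q.1 : ℕ) + 1, by have := q.1.isLt; omega⟩, q.2)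

/-- `L = λX + Y ∈ 𝕃₁(P)` with right ansatz vector `v` has full `Z`-rank. -/
def FullZrank1 {k m n : ℕ} (Yc : Matrix (Fin k × Fin m) (Fin k × Fin n) F)
    (v : Fin k → F) : Prop :=
  ∃ (M : Matrix (Fin k) (Fin k) F) (α : F),
    IsUnit M ∧ α ≠ 0 ∧ M.mulVec v = e1 α ∧ (Zmat1 M Yc).rank = (k - 1) * n

/-- `L = λX + Y ∈ 𝕃₂(P)` with left ansatz vector `w` has full `Z`-rank. -/
def FullZrank2 {k m n : ℕ} (Yc : Matrix (Fin k × Fin m) (Fin k × Fin n) F)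
    (w : Fin k → F) : Prop :=
  ∃ (M : Matrix (Fin k) (Fin k) F) (α : F),
    IsUnit M ∧ α ≠ 0 ∧ M.mulVec w = e1 α ∧ (Zmat2 M Yc).rank = (k - 1) * m

/-! ### null spaces, minimal bases and minimal indices over `F(λ)` -/

/-- A matrix polynomial viewed as a matrix over the field of rational functions. -/
def matRF {ρ γ : Type*} (P : Matrix ρ γ F[X]) : Matrix ρ γ (RatFunc F) :=
  P.map (algebraMap F[X] (RatFunc F))

/-- The right null space `N_r(P) = {x(λ) : P(λ) x(λ) ≡ 0}` over `F(λ)`. -/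
def Nr {ρ γ : Type*} [Fintype γ] (P : Matrix ρ γ F[X]) :
    Submodule (RatFunc F) (γ → RatFunc F) :=
  LinearMap.ker (Matrix.mulVecLin (matRF P))

/-- The left null space `N_l(P) = {y(λ) : y(λ)ᵀ P(λ) ≡ 0}` over `F(λ)`. -/
def Nl {ρ γ : Type*} [Fintype ρ] (P : Matrix ρ γ F[X]) :
    Submodule (RatFunc F) (ρ → RatFunc F) :=
  Nr Pᵀ

/-- The normal rank of a matrix polynomial: its rank over `F(λ)`. -/
def nrank {ρ γ : Type*} [Fintype γ] (P : Matrix ρ γ F[X]) : ℕ :=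
  (matRF P).rank

/-- The rational vector determined by a vector polynomial. -/
def polyVec {γ : Type*} (x : γ → F[X]) : γ → RatFunc F :=
  fun i => algebraMap F[X] (RatFunc F) (x i)

/-- A rational vector is a vector polynomial if all its entries are polynomials. -/
def IsVecPoly {γ : Type*} (x : γ → RatFunc F) : Prop :=
  ∃ p : γ → F[X], x = polyVec p

/-- The degree of a vector polynomial: the greatest degree of its components. -/
def polyVecDeg {γ : Type*} [Fintype γ] (x : γ → F[X]) : ℕ :=
  Finset.univ.sup fun i => (x i).natDegree

/-- A polynomial basis of the subspace `V` of `F(λ)^γ`. -/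
def IsPolyBasis {γ ι : Type*} [Fintype γ]
    (V : Submodule (RatFunc F) (γ → RatFunc F)) (b : ι → γ → F[X]) : Prop :=
  LinearIndependent (RatFunc F) (fun i => polyVec (b i)) ∧
    Submodule.span (RatFunc F) (Set.range fun i => polyVec (b i)) = V

/-- A minimal basis of `V`: a polynomial basis of least order (sum of degrees). -/
def IsMinimalBasis {γ ι : Type*} [Fintype γ] [Fintype ι]
    (V : Submodule (RatFunc F) (γ → RatFunc F)) (b : ι → γ → F[X]) : Prop :=
  IsPolyBasis V b ∧
    ∀ (d : ℕ) (b' : Fin d → γ → F[X]), IsPolyBasis V b' →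
      ∑ i, polyVecDeg (b i) ≤ ∑ i, polyVecDeg (b' i)

/-- `ε` is the list of minimal indices of `V`: some minimal basis of `V` has
`ε` as its list of degrees. -/
def HasMinIndices {γ : Type*} [Fintype γ]
    (V : Submodule (RatFunc F) (γ → RatFunc F)) {d : ℕ} (ε : Fin d → ℕ) : Prop :=
  ∃ b : Fin d → γ → F[X], IsMinimalBasis V b ∧ ∀ i, polyVecDeg (b i) = ε i

/-- `Λ_k(λ) ⊗ x(λ)`. -/
def lamTensor {n : ℕ} (k : ℕ) (x : Fin n → RatFunc F) : Fin k × Fin n → RatFunc F :=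
  fun p => algebraMap F[X] (RatFunc F) (Polynomial.X ^ (k - 1 - (p.1 : ℕ))) * x p.2

/-- The matrix `vᵀ ⊗ I_m` over `F(λ)`; `𝓛_v(y) = (vproj v).mulVec y`. -/
def vproj {k m : ℕ} (v : Fin k → F) : Matrix (Fin m) (Fin k × Fin m) (RatFunc F) :=
  Matrix.of fun r p =>
    if r = p.2 then algebraMap F[X] (RatFunc F) (Polynomial.C (v p.1)) else 0

/-- `(vᵀ ⊗ I_m) y` at the level of vector polynomials. -/
def LvPoly {k m : ℕ} (v : Fin k → F) (y : Fin k × Fin m → F[X]) : Fin m → F[X] :=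
  fun r => ∑ i : Fin k, Polynomial.C (v i) * y (i, r)

/-- The rational subspace spanned by the rows of a matrix polynomial. -/
def rowSpan {ρ γ : Type*} [Fintype γ] (B : Matrix ρ γ F[X]) :
    Submodule (RatFunc F) (γ → RatFunc F) :=
  Submodule.span (RatFunc F) (Set.range fun i => polyVec (B i))

/-- A matrix polynomial is a minimal basis if its rows form a minimal basis of the
rational subspace they span. -/
def IsMinimalBasisMat {ρ γ : Type*} [Fintype ρ] [Fintype γ] (B : Matrix ρ γ F[X]) : Prop :=
  IsMinimalBasis (rowSpan B) (fun i => B i)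

/-- Dual minimal bases: `B ∈ F[λ]^{n₁×n}`, `C ∈ F[λ]^{n₂×n}` minimal bases with
`n₁ + n₂ = n` and `B Cᵀ = 0`. -/
def DualMinBases {ρ ρ' γ : Type*} [Fintype ρ] [Fintype ρ'] [Fintype γ]
    (B : Matrix ρ γ F[X]) (Cm : Matrix ρ' γ F[X]) : Prop :=
  IsMinimalBasisMat B ∧ IsMinimalBasisMat Cm ∧
    Fintype.card ρ + Fintype.card ρ' = Fintype.card γ ∧ B * Cmᵀ = 0

/-! ### norms, singular values -/

/-- Square of the Frobenius norm of a constant matrix. -/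
def frobSq {ρ γ : Type*} [Fintype ρ] [Fintype γ] (Ac : Matrix ρ γ F) : ℝ :=
  ∑ i, ∑ j, ‖Ac i j‖ ^ 2

/-- `‖λX + Y‖_F = sqrt(‖X‖_F² + ‖Y‖_F²)`. -/
def penFrob {ρ γ : Type*} [Fintype ρ] [Fintype γ] (Xc Yc : Matrix ρ γ F) : ℝ :=
  Real.sqrt (frobSq Xc + frobSq Yc)

/-- `‖P‖_F = sqrt(∑ ‖A_i‖_F²)` for `P(λ) = ∑ λ^i A_i`. -/
def famFrob {k m n : ℕ} (A : Fin (k + 1) → Matrix (Fin m) (Fin n) F) : ℝ :=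
  Real.sqrt (∑ i, frobSq (A i))

/-- `‖P‖_F` for a matrix polynomial of grade `g`. -/
def mpolyFrob {ρ γ : Type*} [Fintype ρ] [Fintype γ] (g : ℕ) (P : Matrix ρ γ F[X]) : ℝ :=
  Real.sqrt (∑ i, ∑ j, ∑ d ∈ Finset.range (g + 1), ‖(P i j).coeff d‖ ^ 2)

/-- Square of the Euclidean norm of a vector. -/
def vecNormSq {ι : Type*} [Fintype ι] (x : ι → F) : ℝ := ∑ i, ‖x i‖ ^ 2

/-- The smallest singular value of a matrix. -/
def sigmaMin {ρ γ : Type*} [Fintype ρ] [Fintype γ] (Ac : Matrix ρ γ F) : ℝ :=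
  if Fintype.card γ ≤ Fintype.card ρ then
    sInf {r : ℝ | ∃ x : γ → F, vecNormSq x = 1 ∧ r = Real.sqrt (vecNormSq (Ac.mulVec x))}
  else
    sInf {r : ℝ | ∃ y : ρ → F, vecNormSq y = 1 ∧ r = Real.sqrt (vecNormSq (Acᴴ.mulVec y))}

/-- The spectral norm (2-norm) of a matrix. -/
def norm2 {ρ γ : Type*} [Fintype ρ] [Fintype γ] (Ac : Matrix ρ γ F) : ℝ :=
  sSup {r : ℝ | ∃ x : γ → F, vecNormSq x = 1 ∧ r = Real.sqrt (vecNormSq (Ac.mulVec x))}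

/-- `κ₂(D) = ‖D‖₂ ‖D⁻¹‖₂`. -/
def cond2 {ρ : Type*} [Fintype ρ] [DecidableEq ρ] (Dc : Matrix ρ ρ F) : ℝ :=
  norm2 Dc * norm2 Dc⁻¹

/-! ### pencils used in the backward error analysis -/

/-- `B(λ) = λ [0 ∣ -R̃] + [R̃ ∣ 0]`, i.e. `R̃ (H_{k-1}(λ) ⊗ I_n)` up to sign conventions. -/
def Bpencil {k n : ℕ} (R : Matrix (Fin (k - 1) × Fin n) (Fin (k - 1) × Fin n) F) :
    Matrix (Fin (k - 1) × Fin n) (Fin k × Fin n) F[X] :=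
  Matrix.of fun p q =>
    (if h : (q.1 : ℕ) < k - 1 then Polynomial.C (R p (⟨(q.1 : ℕ), h⟩, q.2)) else 0) +
    (if h : 0 < (q.1 : ℕ) then
        Polynomial.X *
          Polynomial.C (-R p (⟨(q.1 : ℕ) - 1, by have := q.1.isLt; omega⟩, q.2))
      else 0)

/-- The coefficient of `λ` in `H_{k-1}(λ) ⊗ I_n`. -/
def Hlam (F : Type*) [RCLike F] (k n : ℕ) :
    Matrix (Fin (k - 1) × Fin n) (Fin k × Fin n) F :=
  Matrix.of fun p q => if p.2 = q.2 ∧ (q.1 : ℕ) = (p.1 : ℕ) + 1 then 1 else 0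

/-- The constant coefficient of `H_{k-1}(λ) ⊗ I_n`. -/
def Hconst (F : Type*) [RCLike F] (k n : ℕ) :
    Matrix (Fin (k - 1) × Fin n) (Fin k × Fin n) F :=
  Matrix.of fun p q => if p.2 = q.2 ∧ (q.1 : ℕ) = (p.1 : ℕ) then -1 else 0

/-- The convolution matrix `C_j(λ Xc + Yc)` of a pencil, with `j+1` block columns. -/
def convPencil {ρ γ : Type*} (Xc Yc : Matrix ρ γ F) (j : ℕ) :
    Matrix (Fin (j + 2) × ρ) (Fin (j + 1) × γ) F :=
  Matrix.of fun r c =>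
    if (r.1 : ℕ) = (c.1 : ℕ) then Xc r.2 c.2
    else if (r.1 : ℕ) = (c.1 : ℕ) + 1 then Yc r.2 c.2 else 0

/-- λ-coefficient of the trimmed pencil `L̂_t(λ)`:
`[[α A_k, X₁₂],[0, -R̃]]` with row split `m + (k-1)n`. -/
def LtX {k m n : ℕ} (α : F) (Ak : Matrix (Fin m) (Fin n) F)
    (X12 : Matrix (Fin m) (Fin (k - 1) × Fin n) F)
    (R : Matrix (Fin (k - 1) × Fin n) (Fin (k - 1) × Fin n) F) :
    Matrix (Fin m ⊕ (Fin (k - 1) × Fin n)) (Fin k × Fin n) F :=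
  Matrix.of fun s q =>
    Sum.elim
      (fun r => if h : (q.1 : ℕ) = 0 then α * Ak r q.2
        else X12 r (⟨(q.1 : ℕ) - 1, by have := q.1.isLt; omega⟩, q.2))
      (fun p => if h : (q.1 : ℕ) = 0 then 0
        else -R p (⟨(q.1 : ℕ) - 1, by have := q.1.isLt; omega⟩, q.2)) s

/-- Constant coefficient of the trimmed pencil `L̂_t(λ)`:
`[[Y₁₁, α A₀],[R̃, 0]]` with row split `m + (k-1)n`. -/
def LtY {k m n : ℕ} (α : F) (A0 : Matrix (Fin m) (Fin n) F)
    (Y11 : Matrix (Fin m) (Fin (k - 1) × Fin n) F)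
    (R : Matrix (Fin (k - 1) × Fin n) (Fin (k - 1) × Fin n) F) :
    Matrix (Fin m ⊕ (Fin (k - 1) × Fin n)) (Fin k × Fin n) F :=
  Matrix.of fun s q =>
    Sum.elim
      (fun r => if h : (q.1 : ℕ) < k - 1 then Y11 r (⟨(q.1 : ℕ), h⟩, q.2)
        else α * A0 r q.2)
      (fun p => if h : (q.1 : ℕ) < k - 1 then R p (⟨(q.1 : ℕ), h⟩, q.2) else 0) s

/-! ### trimming -/

/-- The rows `[0 ∣ Q₂*] (M ⊗ I_m)`. -/
def bottomRows {k m n c : ℕ} (M : Matrix (Fin k) (Fin k) F)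
    (Q : Matrix (Fin (k - 1) × Fin m) ((Fin (k - 1) × Fin n) ⊕ Fin c) F) :
    Matrix (Fin c) (Fin k × Fin m) F :=
  (Matrix.of fun (j : Fin c) (p : Fin k × Fin m) =>
      if h : (p.1 : ℕ) = 0 then 0
      else star (Q (⟨(p.1 : ℕ) - 1, by have := p.1.isLt; omega⟩, p.2) (Sum.inr j)))
    * kronId M

/-- The square matrix `[D ; [0 ∣ Q₂*](M ⊗ I_m)]` whose invertibility makes `D` admissible. -/
def trimAux {k m n c : ℕ} (M : Matrix (Fin k) (Fin k) F)
    (Q : Matrix (Fin (k - 1) × Fin m) ((Fin (k - 1) × Fin n) ⊕ Fin c) F)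
    (D : Matrix (Fin m ⊕ (Fin (k - 1) × Fin n)) (Fin k × Fin m) F) :
    Matrix ((Fin m ⊕ (Fin (k - 1) × Fin n)) ⊕ Fin c) (Fin k × Fin m) F :=
  Matrix.of (Sum.elim (fun i j => D i j) (fun i j => bottomRows M Q i j))

/-- The columns `(M̂ᵀ ⊗ I_n) [0 ; Q₂]`. -/
def rightCols {k m n c : ℕ} (M : Matrix (Fin k) (Fin k) F)
    (Q : Matrix (Fin (k - 1) × Fin n) ((Fin (k - 1) × Fin m) ⊕ Fin c) F) :
    Matrix (Fin k × Fin n) (Fin c) F :=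
  kronId Mᵀ *
    (Matrix.of fun (q : Fin k × Fin n) (j : Fin c) =>
      if h : (q.1 : ℕ) = 0 then 0
      else Q (⟨(q.1 : ℕ) - 1, by have := q.1.isLt; omega⟩, q.2) (Sum.inr j))

/-- The square matrix `[D̂ ∣ (M̂ᵀ ⊗ I_n)[0 ; Q₂]]` whose invertibility makes `D̂` admissible. -/
def trimAux2 {k m n c : ℕ} (M : Matrix (Fin k) (Fin k) F)
    (Q : Matrix (Fin (k - 1) × Fin n) ((Fin (k - 1) × Fin m) ⊕ Fin c) F)
    (D : Matrix (Fin k × Fin n) (Fin n ⊕ (Fin (k - 1) × Fin m)) F) :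
    Matrix (Fin k × Fin n) ((Fin n ⊕ (Fin (k - 1) × Fin m)) ⊕ Fin c) F :=
  Matrix.of fun q s => Sum.elim (fun t => D q t) (fun j => rightCols M Q q j) s

/-! ### Completing a full-rank block -/

/-- `I_{k-1} ⊗ I_{m,n}` for `n ≤ m`. -/
def blockEmbed (R : Type*) [CommRing R] (K : ℕ) {m n : ℕ} (hmn : n ≤ m) :
    Matrix (Fin K × Fin m) (Fin K × Fin n) R :=
  (1 : Matrix (Fin K × Fin m) (Fin K × Fin m) R).submatrix id
    (Prod.map id (Fin.castLE hmn))

lemma blockEmbed_transpose_mul {R : Type*} [CommRing R] {K m n : ℕ} (hmn : n ≤ m) {γ : Type*}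
    (B : Matrix (Fin K × Fin m) γ R) :
    (blockEmbed R K hmn)ᵀ * B = B.submatrix (Prod.map id (Fin.castLE hmn)) id := by
  ext p q
  simp [blockEmbed, Matrix.mul_apply, Matrix.one_apply]

lemma blockEmbed_transpose_mul_self {R : Type*} [CommRing R] {K m n : ℕ} (hmn : n ≤ m) :
    (blockEmbed R K hmn)ᵀ * blockEmbed R K hmn = 1 := by
  rw [blockEmbed_transpose_mul]
  ext p q
  simp [blockEmbed, Matrix.one_apply, Prod.ext_iff]

lemma map_blockEmbed {R S : Type*} [CommRing R] [CommRing S] (f : R →+* S) {K m n : ℕ}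
    (hmn : n ≤ m) : (blockEmbed R K hmn).map f = blockEmbed S K hmn := by
  ext p q
  simp [blockEmbed, Matrix.one_apply, apply_ite f]

/-- If the rows of `Z` selected by `blockEmbed` form a nonsingular matrix, then `Z` can be
brought to `blockEmbed` by a nonsingular row transformation. -/
lemma exists_mul_eq_blockEmbed {R : Type*} [CommRing R] {K m n : ℕ} (hmn : n ≤ m)
    (Z : Matrix (Fin K × Fin m) (Fin K × Fin n) R)
    (hZ : IsUnit (Z.submatrix (Prod.map id (Fin.castLE hmn)) id).det) :
    ∃ T : Matrix (Fin K × Fin m) (Fin K × Fin m) R,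
      IsUnit T.det ∧ T * Z = blockEmbed R K hmn := by
  set J := blockEmbed R K hmn
  set D : Matrix (Fin K × Fin m) (Fin K × Fin m) R := 1 + (Z - J) * Jᵀ with hD
  have hJ : Jᵀ * J = 1 := blockEmbed_transpose_mul_self hmn
  have hdet : IsUnit D.det := by
    rw [hD, Matrix.det_one_add_mul_comm, Matrix.mul_sub, hJ, blockEmbed_transpose_mul]
    simpa using hZ
  have hDJ : D * J = Z := by
    rw [hD, Matrix.add_mul, Matrix.mul_assoc, hJ]
    simp
  refine ⟨D⁻¹, Matrix.isUnit_nonsing_inv_det _ hdet, ?_⟩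
  rw [← hDJ, Matrix.nonsing_inv_mul_cancel_left _ _ hdet]

lemma rank_eq_of_isUnit_det_submatrix {K m n : ℕ} (hmn : n ≤ m)
    (Z : Matrix (Fin K × Fin m) (Fin K × Fin n) F)
    (hZ : IsUnit (Z.submatrix (Prod.map id (Fin.castLE hmn)) id).det) :
    Z.rank = K * n := by
  refine le_antisymm (Z.rank_le_card_width.trans_eq (by simp)) ?_
  have h := Matrix.rank_mul_le_right (blockEmbed F K hmn)ᵀ Z
  rw [blockEmbed_transpose_mul,
    Matrix.rank_of_isUnit _ ((Matrix.isUnit_iff_isUnit_det _).2 hZ)] at h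
  simpa using h

/-! ### A criterion for g-linearizations -/

/-- Splits off the leading block of `Fin (K + 1) × Fin m`. -/
def splitZero (K m : ℕ) : Fin m ⊕ (Fin K × Fin m) ≃ Fin (K + 1) × Fin m where
  toFun := Sum.elim (fun r => (0, r)) fun p => (p.1.succ, p.2)
  invFun p := Fin.cases (motive := fun _ => Fin m ⊕ (Fin K × Fin m)) (Sum.inl p.2)
    (fun i => Sum.inr (i, p.2)) p.1
  left_inv := by rintro (r | ⟨i, r⟩) <;> rfl
  right_inv := by
    rintro ⟨i, r⟩
    cases i using Fin.cases <;> rfl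

lemma glinTarget_submatrix {K m n : ℕ} (hmn : n ≤ m) (P : Matrix (Fin m) (Fin n) F[X]) :
    (glinTarget P : Matrix (Fin (K + 1) × Fin m) (Fin (K + 1) × Fin n) F[X]).submatrix
      (splitZero K m) (splitZero K n) = Matrix.fromBlocks P 0 0 (blockEmbed F[X] K hmn) := by
  ext (r | ⟨i, r⟩) (c | ⟨j, c⟩) : 1
  · simp [glinTarget, splitZero]
  · simp [glinTarget, splitZero, (Fin.succ_ne_zero j).symm]
  · simp [glinTarget, splitZero]
  · simp [glinTarget, splitZero, blockEmbed, Matrix.one_apply, Prod.ext_iff,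
      Fin.ext_iff (a := r), ite_and]

/-- `L` is a g-linearization of `P` if it maps the columns `Λ` to `v ⊗ P`, its reduced lower
block row factors as `Z H` with `Z` of full rank, and `[ω ; H]`, `[Λ ∣ N]` are mutually inverse. -/
lemma isGLin_of_factor {K m n : ℕ} (hmn : n ≤ m) {P : Matrix (Fin m) (Fin n) F[X]}
    {L : Matrix (Fin (K + 1) × Fin m) (Fin (K + 1) × Fin n) F[X]} {v : Fin (K + 1) → F}
    (hv : v 0 ≠ 0) {Z : Matrix (Fin K × Fin m) (Fin K × Fin n) F}
    (hZ : IsUnit (Z.submatrix (Prod.map id (Fin.castLE hmn)) id).det)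
    {Λ : Matrix (Fin (K + 1) × Fin n) (Fin n) F[X]}
    {N : Matrix (Fin (K + 1) × Fin n) (Fin K × Fin n) F[X]}
    {ω : Matrix (Fin n) (Fin (K + 1) × Fin n) F[X]}
    {H : Matrix (Fin K × Fin n) (Fin (K + 1) × Fin n) F[X]}
    (hωΛ : ω * Λ = 1) (hωN : ω * N = 0) (hHΛ : H * Λ = 0) (hHN : H * N = 1)
    (hL : L * Λ = vkron v P)
    (hbot : ∀ i r q, C (v 0) * L (i.succ, r) q - C (v i.succ) * L (0, r) q
      = (Z.map C * H) (i, r) q) : IsGLin P L := by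
  obtain ⟨T₀, hT₀, hTZ₀⟩ := exists_mul_eq_blockEmbed hmn Z hZ
  set T := T₀.map C with hTdef
  set J := blockEmbed F[X] K hmn with hJdef
  have hT : IsUnit T.det := by
    rw [hTdef, ← RingHom.mapMatrix_apply, ← RingHom.map_det]
    exact hT₀.map C
  have hTZ : T * Z.map C = J := by
    rw [hTdef, ← Matrix.map_mul, hTZ₀, map_blockEmbed]
  have hJ : Jᵀ * J = 1 := blockEmbed_transpose_mul_self hmn
  set top : Matrix (Fin m) (Fin (K + 1) × Fin n) F[X] := Matrix.of fun r q => L (0, r) q with htop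
  set bot : Matrix (Fin K × Fin m) (Fin (K + 1) × Fin n) F[X] :=
    Matrix.of fun p q => L (p.1.succ, p.2) q with hbotdef
  set V : Matrix (Fin K × Fin m) (Fin m) F[X] :=
    Matrix.of fun p r => if p.2 = r then C (v p.1.succ) else 0 with hV
  have hrows : L.submatrix (splitZero K m) id = Matrix.fromRows top bot := by
    ext (r | p) q <;> rfl
  have htopΛ : top * Λ = C (v 0) • P := by
    ext r c : 1
    exact congrFun (congrFun hL (0, r)) c
  have hfac : C (v 0) • bot - V * top = Z.map C * H := by
    ext p q
    rw [← hbot]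
    simp [hV, htop, hbotdef, Matrix.mul_apply]
  have hcol : T * (C (v 0) • bot - V * top) * Λ = 0 := by
    rw [hfac, Matrix.mul_assoc, Matrix.mul_assoc, hHΛ, Matrix.mul_zero, Matrix.mul_zero]
  have hcols : T * (C (v 0) • bot - V * top) * N = J := by
    rw [hfac, Matrix.mul_assoc, Matrix.mul_assoc, hHN, Matrix.mul_one, hTZ]
  have hinv : C (v 0)⁻¹ * C (v 0) = 1 := by rw [← C_mul, inv_mul_cancel₀ hv, C_1]
  set E₁ : Matrix (Fin m ⊕ (Fin K × Fin m)) (Fin m ⊕ (Fin K × Fin m)) F[X] :=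
    Matrix.fromBlocks (C (v 0)⁻¹ • 1) 0 (-(T * V)) (C (v 0) • T) with hE₁
  set E₂ : Matrix (Fin m ⊕ (Fin K × Fin m)) (Fin m ⊕ (Fin K × Fin m)) F[X] :=
    Matrix.fromBlocks 1 (-((C (v 0)⁻¹ • top) * N * Jᵀ)) 0 1 with hE₂
  have hEL : E₁ * Matrix.fromRows top bot =
      Matrix.fromRows (C (v 0)⁻¹ • top) (T * (C (v 0) • bot - V * top)) := by
    rw [hE₁, Matrix.fromBlocks_mul_fromRows]
    congr 1
    · simp
    · simp [Matrix.mul_sub, Matrix.mul_assoc]; abel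
  have hmain : E₂ * E₁ * Matrix.fromRows top bot * Matrix.fromCols Λ N =
      Matrix.fromBlocks P 0 0 J := by
    rw [Matrix.mul_assoc E₂, hEL, Matrix.mul_assoc, Matrix.fromRows_mul_fromCols, hcol, hcols,
      hE₂, Matrix.fromBlocks_multiply]
    have h1 : (C (v 0)⁻¹ • top) * Λ = P := by
      rw [Matrix.smul_mul, htopΛ, smul_smul, hinv, one_smul]
    rw [h1]
    congr 1
    · simp
    · rw [Matrix.neg_mul, Matrix.mul_assoc, hJ]; simp
    · simp
    · simp
  have hE₁u : IsUnit E₁.det := by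
    rw [hE₁, Matrix.det_fromBlocks_zero₁₂, Matrix.det_smul, Matrix.det_smul, Matrix.det_one,
      mul_one]
    have hu : ∀ x : F, x ≠ 0 → IsUnit (C x) := fun x hx => (IsUnit.mk0 x hx).map C
    exact ((hu _ (inv_ne_zero hv)).pow _).mul (((hu _ hv).pow _).mul hT)
  have hE₂u : IsUnit E₂.det := by
    rw [hE₂, Matrix.det_fromBlocks_zero₂₁]
    simp
  refine ⟨(E₂ * E₁).submatrix (splitZero K m).symm (splitZero K m).symm,
    (Matrix.fromCols Λ N).submatrix id (splitZero K n).symm, ?_, ?_, ?_⟩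
  · rw [Matrix.det_submatrix_equiv_self, Matrix.det_mul]
    exact hE₂u.mul hE₁u
  · refine Matrix.isUnit_det_of_left_inverse
      (B := (Matrix.fromRows ω H).submatrix (splitZero K n).symm id) ?_
    rw [show (id : Fin (K + 1) × Fin n → _) = Equiv.refl _ from rfl, Matrix.submatrix_mul_equiv,
      Matrix.fromRows_mul_fromCols, hωΛ, hωN, hHΛ, hHN, Matrix.fromBlocks_one,
      Matrix.submatrix_one_equiv]
  · have hL' : L = (Matrix.fromRows top bot).submatrix (splitZero K m).symm id := by
      rw [← hrows]; simp
    have ht : (glinTarget P : Matrix (Fin (K + 1) × Fin m) (Fin (K + 1) × Fin n) F[X]) =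
        (Matrix.fromBlocks P 0 0 J).submatrix (splitZero K m).symm (splitZero K n).symm := by
      rw [← glinTarget_submatrix hmn]; simp
    rw [ht, ← hmain]
    conv_lhs => rw [hL']
    rw [Matrix.submatrix_mul_equiv, show (id : Fin (K + 1) × Fin n → _) = Equiv.refl _ from rfl,
      Matrix.submatrix_mul_equiv]

/-! ### The two shift matrices -/

lemma sum_ite_castSucc_eq {R : Type*} [CommRing R] {K : ℕ} (f : Fin K → R) (q : Fin (K + 1)) :
    ∑ j, f j * (if j.castSucc = q then 1 else 0) =
      if h : (q : ℕ) < K then f ⟨q, h⟩ else 0 := by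
  cases q using Fin.lastCases with
  | last => simp [Fin.ext_iff, fun j : Fin K => j.isLt.ne]
  | cast q => simp

lemma sum_ite_succ_eq {R : Type*} [CommRing R] {K : ℕ} (f : Fin K → R) (q : Fin (K + 1)) :
    ∑ j, f j * (if j.succ = q then 1 else 0) =
      if h : (q : ℕ) = 0 then 0 else f ⟨q - 1, by omega⟩ := by
  cases q using Fin.cases with
  | zero => simp
  | succ q => simp

/-- `a [I 0] + b [0 I]`, as a `K n × (K + 1) n` matrix. -/
def shiftMat {R : Type*} [CommRing R] (K n : ℕ) (a b : R) :
    Matrix (Fin K × Fin n) (Fin (K + 1) × Fin n) R :=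
  Matrix.of fun p q => if p.2 = q.2 then
    a * (if p.1.castSucc = q.1 then 1 else 0) + b * (if p.1.succ = q.1 then 1 else 0) else 0

lemma shiftMat_mul_apply {R : Type*} [CommRing R] {K n : ℕ} (a b : R) {γ : Type*}
    (B : Matrix (Fin (K + 1) × Fin n) γ R) (p : Fin K × Fin n) (q : γ) :
    (shiftMat K n a b * B) p q = a * B (p.1.castSucc, p.2) q + b * B (p.1.succ, p.2) q := by
  simp [shiftMat, Matrix.mul_apply, Fintype.sum_prod_type, add_mul, Finset.sum_add_distrib]

lemma mul_shiftMat_apply {R : Type*} [CommRing R] {K n : ℕ} (a b : R) {ρ : Type*}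
    (B : Matrix ρ (Fin K × Fin n) R) (p : ρ) (q : Fin (K + 1) × Fin n) :
    (B * shiftMat K n a b) p q =
      a * (if h : (q.1 : ℕ) < K then B p (⟨q.1, h⟩, q.2) else 0) +
      b * (if h : (q.1 : ℕ) = 0 then 0 else B p (⟨q.1 - 1, by omega⟩, q.2)) := by
  rw [← sum_ite_castSucc_eq (fun j => B p (j, q.2)), ← sum_ite_succ_eq (fun j => B p (j, q.2))]
  simp only [shiftMat, Matrix.mul_apply, Fintype.sum_prod_type, Matrix.of_apply, mul_ite, mul_zero,
    Finset.sum_ite_eq', Finset.mem_univ, if_true, Finset.mul_sum, ← Finset.sum_add_distrib]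
  refine Finset.sum_congr rfl fun j _ => ?_
  split_ifs <;> ring

/-! ### The ansatz identity -/

lemma sum_grade {K : ℕ} (f : Fin (K + 2) → F[X]) :
    ∑ i, f i = f 0 + (∑ j : Fin K, f ⟨K - j, by omega⟩) + f (Fin.last (K + 1)) := by
  rw [Fin.sum_univ_succ, Fin.sum_univ_castSucc, ← Equiv.sum_comp Fin.revPerm, ← add_assoc]
  congr 3
  refine funext fun j => congrArg f (Fin.ext ?_)
  simp only [Fin.revPerm_apply, Fin.val_succ, Fin.val_castSucc, Fin.val_rev]
  omega

lemma reflect_matPoly_apply {k m n : ℕ} (A : Fin (k + 1) → Matrix (Fin m) (Fin n) F)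
    (r : Fin m) (c : Fin n) :
    revMat k (matPoly A) r c = ∑ i : Fin (k + 1), C (A i r c) * X ^ (k - (i : ℕ)) := by
  have h := map_sum (AddMonoidHom.mk' (reflect k : F[X] → F[X]) fun f g => reflect_add f g k)
    (fun i : Fin (k + 1) => C (A i r c) * X ^ (i : ℕ)) Finset.univ
  simp only [AddMonoidHom.mk'_apply] at h
  simp only [revMat, Matrix.map_apply, matPoly, Matrix.of_apply]
  rw [h]
  refine Finset.sum_congr rfl fun i _ => ?_
  rw [reflect_C_mul_X_pow, revAt_le (Nat.lt_succ_iff.1 i.isLt)]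

lemma reflect_one_pencil_apply {ρ γ : Type*} (Xc Yc : Matrix ρ γ F) (p : ρ) (q : γ) :
    revMat 1 (pencil Xc Yc) p q = C (Xc p q) + C (Yc p q) * X := by
  have h := reflect_C_mul_X_pow (R := F) 1 1 (c := Xc p q)
  rw [pow_one, revAt_le le_rfl] at h
  simp [revMat, pencil, reflect_add, h, reflect_C]

lemma L1X_apply_zero {K m n : ℕ} (A : Fin (K + 2) → Matrix (Fin m) (Fin n) F)
    (v : Fin (K + 1) → F) (W : Matrix (Fin (K + 1) × Fin m) (Fin K × Fin n) F)
    (p : Fin (K + 1) × Fin m) (c : Fin n) :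
    L1X A v W p (0, c) = v p.1 * A (Fin.last (K + 1)) p.2 c := by
  simp [L1X]

lemma pencil_mul_Lam {K m n : ℕ} (A : Fin (K + 2) → Matrix (Fin m) (Fin n) F)
    (v : Fin (K + 1) → F) (W : Matrix (Fin (K + 1) × Fin m) (Fin K × Fin n) F) :
    pencil (L1X A v W) (L1Y A v W) * Lam F (K + 1) n = vkron v (matPoly A) := by
  ext ⟨i, r⟩ c : 1
  simp only [Matrix.mul_apply, Fintype.sum_prod_type, Lam, Matrix.of_apply, mul_ite, mul_zero,
    Finset.sum_ite_eq', Finset.mem_univ, if_true, vkron, matPoly, pencil, add_mul,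
    Finset.sum_add_distrib]
  rw [Fin.sum_univ_succ, Fin.sum_univ_castSucc (n := K), sum_grade, L1X_apply_zero]
  simp only [L1X, L1Y, Matrix.of_apply, Fin.val_zero, Fin.val_succ, Fin.val_castSucc, Fin.val_last,
    Nat.add_sub_cancel, dite_true, Fin.is_lt, lt_irrefl, dite_false, Nat.succ_ne_zero,
    Fin.eta, mul_add, Finset.mul_sum, Nat.sub_zero, Nat.sub_self, pow_zero, mul_one, C_mul,
    C_add, C_neg, add_mul, Finset.sum_add_distrib]
  have h : ∑ j : Fin K, -C (W (i, r) (j, c)) * X * X ^ (K - (j + 1 : ℕ)) +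
      ∑ j : Fin K, C (W (i, r) (j, c)) * X ^ (K - (j : ℕ)) = 0 := by
    rw [← Finset.sum_add_distrib]
    refine Finset.sum_eq_zero fun j _ => ?_
    rw [show K - (j : ℕ) = K - (j + 1) + 1 by omega, pow_succ]
    ring
  simp only [mul_assoc] at h ⊢
  linear_combination h

/-- `(1, λ, …, λ^{k-1})ᵀ ⊗ I_n`. -/
def revLam (F : Type*) [RCLike F] (k n : ℕ) : Matrix (Fin k × Fin n) (Fin n) F[X] :=
  Matrix.of fun p c => if p.2 = c then X ^ (p.1 : ℕ) else 0

lemma revMat_pencil_mul_revLam {K m n : ℕ} (A : Fin (K + 2) → Matrix (Fin m) (Fin n) F)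
    (v : Fin (K + 1) → F) (W : Matrix (Fin (K + 1) × Fin m) (Fin K × Fin n) F) :
    revMat 1 (pencil (L1X A v W) (L1Y A v W)) * revLam F (K + 1) n =
      vkron v (revMat (K + 1) (matPoly A)) := by
  ext ⟨i, r⟩ c : 1
  simp only [Matrix.mul_apply, Fintype.sum_prod_type, revLam, Matrix.of_apply, mul_ite, mul_zero,
    Finset.sum_ite_eq', Finset.mem_univ, if_true, vkron, reflect_matPoly_apply,
    reflect_one_pencil_apply, add_mul, Finset.sum_add_distrib]
  rw [Fin.sum_univ_succ, Fin.sum_univ_castSucc (n := K), sum_grade, L1X_apply_zero]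
  simp only [L1X, L1Y, Matrix.of_apply, Fin.val_zero, Fin.val_succ, Fin.val_castSucc, Fin.val_last,
    Nat.add_sub_cancel, dite_true, Fin.is_lt, lt_irrefl, dite_false, Nat.succ_ne_zero,
    Fin.eta, mul_add, Finset.mul_sum, Nat.sub_zero, Nat.sub_self, pow_zero, mul_one, C_mul,
    C_add, C_neg, add_mul, Finset.sum_add_distrib]
  have h : ∑ j : Fin K, -C (W (i, r) (j, c)) * X ^ (j + 1 : ℕ) +
      ∑ j : Fin K, C (W (i, r) (j, c)) * X * X ^ (j : ℕ) = 0 := by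
    rw [← Finset.sum_add_distrib]
    exact Finset.sum_eq_zero fun j _ => by ring
  have hA : ∑ j : Fin K, C (v i) * C (A ⟨K - j, by omega⟩ r c) * X * X ^ (j : ℕ) =
      ∑ j : Fin K, C (v i) * (C (A ⟨K - j, by omega⟩ r c) * X ^ (K + 1 - (K - j : ℕ))) := by
    refine Finset.sum_congr rfl fun j _ => ?_
    rw [show K + 1 - (K - (j : ℕ)) = j + 1 by omega]
    ring
  linear_combination h + hA

/-! ### Pencils with nonsingular selected `Z`-block -/

/-- The `Z`-matrix attached to the parameters `(v, W)` for the transformation whose rows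
are `e₁ᵀ` and `v₁ e_{i+1}ᵀ - v_{i+1} e₁ᵀ`. -/
def zParam {K m n : ℕ} (v : Fin (K + 1) → F)
    (W : Matrix (Fin (K + 1) × Fin m) (Fin K × Fin n) F) :
    Matrix (Fin K × Fin m) (Fin K × Fin n) F :=
  Matrix.of fun p q => v 0 * W (p.1.succ, p.2) q - v p.1.succ * W (0, p.2) q

/-- The transformation with rows `e₁ᵀ` and `v₁ e_{i+1}ᵀ - v_{i+1} e₁ᵀ`. -/
def elimMat {K : ℕ} (v : Fin (K + 1) → F) : Matrix (Fin (K + 1)) (Fin (K + 1)) F :=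
  Matrix.of fun i j => Fin.cases (motive := fun _ => F) (if j = 0 then 1 else 0)
    (fun i => v 0 * (if j = i.succ then 1 else 0) - v i.succ * (if j = 0 then 1 else 0)) i

lemma isUnit_elimMat {K : ℕ} {v : Fin (K + 1) → F} (hv : v 0 ≠ 0) : IsUnit (elimMat v) := by
  rw [Matrix.isUnit_iff_isUnit_det, Matrix.det_of_isLowerTriangular]
  · rw [Fin.prod_univ_succ]
    simp [elimMat, hv]
  · intro i j hij
    replace hij : i < j := hij
    have hj : j ≠ 0 := (Fin.zero_le i |>.trans_lt hij).ne'
    cases i using Fin.cases with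
    | zero => simp [elimMat, hj]
    | succ i => simp [elimMat, hj, hij.ne']

lemma sum_elimMat_succ_mul {K : ℕ} (v f : Fin (K + 1) → F) (i : Fin K) :
    ∑ j, elimMat v i.succ j * f j = v 0 * f i.succ - v i.succ * f 0 := by
  simp [elimMat, sub_mul, Finset.sum_sub_distrib]

lemma elimMat_mulVec {K : ℕ} (v : Fin (K + 1) → F) : (elimMat v).mulVec v = e1 (v 0) := by
  ext i
  cases i using Fin.cases with
  | zero => simp [elimMat, e1, Matrix.mulVec, dotProduct]
  | succ i =>
    simp only [Matrix.mulVec, dotProduct, sum_elimMat_succ_mul, e1, Fin.val_succ, Nat.succ_ne_zero,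
      if_false]
    ring

lemma kronId_mul_apply {k m : ℕ} {γ : Type*} (M : Matrix (Fin k) (Fin k) F)
    (B : Matrix (Fin k × Fin m) γ F) (i : Fin k) (r : Fin m) (q : γ) :
    (kronId (m := m) M * B : Matrix (Fin k × Fin m) γ F) (i, r) q = ∑ j, M i j * B (j, r) q := by
  simp [kronId, Matrix.mul_apply, Fintype.sum_prod_type]

lemma Zmat1_elimMat {K m n : ℕ} (A : Fin (K + 2) → Matrix (Fin m) (Fin n) F)
    (v : Fin (K + 1) → F) (W : Matrix (Fin (K + 1) × Fin m) (Fin K × Fin n) F) :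
    Zmat1 (elimMat v) (L1Y A v W) = zParam v W := by
  ext ⟨i, r⟩ ⟨j, c⟩
  have hj : ((j : Fin K).castSucc : ℕ) < K := j.isLt
  refine (kronId_mul_apply (elimMat v) (L1Y A v W) (Fin.succ i) r (Fin.castSucc j, c)).trans ?_
  rw [sum_elimMat_succ_mul v fun l => L1Y A v W (l, r) (Fin.castSucc j, c)]
  simp only [L1Y, zParam, Matrix.of_apply, Nat.add_sub_cancel, dif_pos hj]
  simp only [Fin.val_castSucc, Fin.eta]
  ring

lemma fullZrank1_of_isUnit {K m n : ℕ} (hmn : n ≤ m)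
    (A : Fin (K + 2) → Matrix (Fin m) (Fin n) F) {v : Fin (K + 1) → F} (hv : v 0 ≠ 0)
    {W : Matrix (Fin (K + 1) × Fin m) (Fin K × Fin n) F}
    (hZ : IsUnit ((zParam v W).submatrix (Prod.map id (Fin.castLE hmn)) id).det) :
    FullZrank1 (L1Y A v W) v :=
  ⟨elimMat v, v 0, isUnit_elimMat hv, hv, elimMat_mulVec v,
    (congrArg Matrix.rank (Zmat1_elimMat A v W)).trans (rank_eq_of_isUnit_det_submatrix hmn _ hZ)⟩

lemma one_submatrix_mul_apply {R ι κ γ : Type*} [Semiring R] [Fintype ι] [DecidableEq ι]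
    (f : κ → ι) (B : Matrix ι γ R) (r : κ) (q : γ) :
    ((1 : Matrix ι ι R).submatrix f id * B) r q = B (f r) q := by
  simp [Matrix.mul_apply, Matrix.one_apply]

lemma isGLin_pencil_of_isUnit {K m n : ℕ} (hmn : n ≤ m)
    (A : Fin (K + 2) → Matrix (Fin m) (Fin n) F) {v : Fin (K + 1) → F} (hv : v 0 ≠ 0)
    {W : Matrix (Fin (K + 1) × Fin m) (Fin K × Fin n) F}
    (hZ : IsUnit ((zParam v W).submatrix (Prod.map id (Fin.castLE hmn)) id).det) :
    IsGLin (matPoly A) (pencil (L1X A v W) (L1Y A v W)) := by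
  refine isGLin_of_factor hmn hv hZ (Λ := Lam F (K + 1) n)
    (N := Matrix.of fun p q => if p.2 = q.2 ∧ (p.1 : ℕ) ≤ q.1 then X ^ ((q.1 : ℕ) - p.1) else 0)
    (ω := (1 : Matrix _ _ F[X]).submatrix (fun r => (Fin.last K, r)) id)
    (H := shiftMat K n 1 (-X)) ?_ ?_ ?_ ?_ (pencil_mul_Lam A v W) ?_
  · ext r c : 1
    rw [one_submatrix_mul_apply]
    simp [Lam, Matrix.one_apply]
  · ext r ⟨j, c⟩ : 1
    rw [one_submatrix_mul_apply]
    simp [j.isLt.not_ge]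
  · ext ⟨i, r⟩ c : 1
    rw [shiftMat_mul_apply]
    have hi : K - (i : ℕ) = K - (i + 1) + 1 := by omega
    simp only [Lam, Matrix.of_apply, Fin.val_castSucc, Fin.val_succ, Nat.add_sub_cancel,
      Matrix.zero_apply]
    split_ifs
    · rw [hi]; ring
    · ring
  · ext ⟨i, r⟩ ⟨j, c⟩ : 1
    rw [shiftMat_mul_apply]
    simp only [Matrix.of_apply, Fin.val_castSucc, Fin.val_succ, Matrix.one_apply, Prod.mk.injEq,
      Fin.ext_iff (a := i)]
    by_cases hr : r = c
    · rcases lt_trichotomy (i : ℕ) j with h | h | h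
      · have hj : (j : ℕ) - i = j - (i + 1) + 1 := by omega
        simp [hr, h, h.le, h.ne, hj]
        ring
      · simp [hr, h]
      · simp [hr, h.ne', h.not_ge, (h.trans (Nat.lt_succ_self _)).not_ge]
    · simp [hr]
  · intro i r q
    rw [mul_shiftMat_apply]
    simp only [pencil, L1X, L1Y, zParam, Matrix.of_apply, Matrix.map_apply, Nat.add_sub_cancel]
    split_ifs <;> simp <;> ring

lemma isGLin_revMat_pencil_of_isUnit {K m n : ℕ} (hmn : n ≤ m)
    (A : Fin (K + 2) → Matrix (Fin m) (Fin n) F) {v : Fin (K + 1) → F} (hv : v 0 ≠ 0)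
    {W : Matrix (Fin (K + 1) × Fin m) (Fin K × Fin n) F}
    (hZ : IsUnit ((zParam v W).submatrix (Prod.map id (Fin.castLE hmn)) id).det) :
    IsGLin (revMat (K + 1) (matPoly A)) (revMat 1 (pencil (L1X A v W) (L1Y A v W))) := by
  refine isGLin_of_factor hmn hv hZ (Λ := revLam F (K + 1) n)
    (N := Matrix.of fun p q =>
      if p.2 = q.2 ∧ (q.1 : ℕ) + 1 ≤ p.1 then -X ^ ((p.1 : ℕ) - (q.1 + 1)) else 0)
    (ω := (1 : Matrix _ _ F[X]).submatrix (fun r => ((0 : Fin (K + 1)), r)) id)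
    (H := shiftMat K n X (-1)) ?_ ?_ ?_ ?_ (revMat_pencil_mul_revLam A v W) ?_
  · ext r c : 1
    rw [one_submatrix_mul_apply]
    simp [revLam, Matrix.one_apply]
  · ext r ⟨j, c⟩ : 1
    rw [one_submatrix_mul_apply]
    simp
  · ext ⟨i, r⟩ c : 1
    rw [shiftMat_mul_apply]
    simp only [revLam, Matrix.of_apply, Fin.val_castSucc, Fin.val_succ, Matrix.zero_apply]
    split_ifs <;> ring
  · ext ⟨i, r⟩ ⟨j, c⟩ : 1
    rw [shiftMat_mul_apply]
    simp only [Matrix.of_apply, Fin.val_castSucc, Fin.val_succ, Matrix.one_apply, Prod.mk.injEq,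
      Fin.ext_iff (a := i)]
    by_cases hr : r = c
    · rcases lt_trichotomy (i : ℕ) j with h | h | h
      · simp [hr, h.ne, h.not_ge, (h.trans (Nat.lt_succ_self _)).not_ge]
      · simp [hr, h]
      · have hj : (i : ℕ) - j = i - (j + 1) + 1 := by omega
        simp [hr, h, h.le, h.ne', hj]
        ring
    · simp [hr]
  · intro i r q
    rw [mul_shiftMat_apply, reflect_one_pencil_apply, reflect_one_pencil_apply]
    simp only [L1X, L1Y, zParam, Matrix.of_apply, Matrix.map_apply, Nat.add_sub_cancel]
    split_ifs <;> simp <;> ring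

/-! ### The genericity polynomial -/

/-- `v₁ det(Z)`, where `Z` consists of selected rows of the `Z`-matrix `zParam v W`, as a
polynomial in the entries of `(v, W)`. -/
def genericPoly (F : Type*) [RCLike F] (K : ℕ) {m n : ℕ} (hmn : n ≤ m) :
    MvPolynomial (Fin (K + 1) ⊕ ((Fin (K + 1) × Fin m) × (Fin K × Fin n))) F :=
  MvPolynomial.X (Sum.inl 0) *
    Matrix.det (Matrix.of fun p q : Fin K × Fin n =>
      MvPolynomial.X (Sum.inl 0) *
          MvPolynomial.X (Sum.inr ((p.1.succ, Fin.castLE hmn p.2), q)) -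
        MvPolynomial.X (Sum.inl p.1.succ) *
          MvPolynomial.X (Sum.inr ((0, Fin.castLE hmn p.2), q)))

lemma eval_genericPoly {K m n : ℕ} (hmn : n ≤ m) (v : Fin (K + 1) → F)
    (W : Matrix (Fin (K + 1) × Fin m) (Fin K × Fin n) F) :
    MvPolynomial.eval (Sum.elim v fun e => W e.1 e.2) (genericPoly F K hmn) =
      v 0 * ((zParam v W).submatrix (Prod.map id (Fin.castLE hmn)) id).det := by
  rw [genericPoly, map_mul, RingHom.map_det, MvPolynomial.eval_X, Sum.elim_inl]
  congr 2
  ext p q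
  simp [zParam]

lemma genericPoly_ne_zero {K m n : ℕ} (hmn : n ≤ m) : genericPoly F K hmn ≠ 0 := by
  intro h
  let W : Matrix (Fin (K + 1) × Fin m) (Fin K × Fin n) F :=
    Matrix.of fun p q => if p = (q.1.succ, Fin.castLE hmn q.2) then 1 else 0
  have he := eval_genericPoly hmn (fun _ => 1) W
  have hone : (zParam (fun _ => 1) W).submatrix (Prod.map id (Fin.castLE hmn)) id = 1 := by
    ext p q
    simp [W, zParam, Matrix.one_apply, Prod.ext_iff, (Fin.succ_ne_zero _).symm]
  rw [hone, h] at he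
  simp at he

/-- **genericity.** For `m ≥ n` there is a nonzero polynomial function `𝒫`
in the `k + k(k−1)mn` entries of the parameters `(v, W)` of `𝕃₁(P)` such that whenever
`𝒫(v, W) ≠ 0`, the corresponding pencil has full `Z`-rank and is a strong
g-linearization of `P(λ)`; in particular almost every pencil in `𝕃₁(P)` is a strong
g-linearization of `P(λ)`. -/
theorem statement_5 {F : Type*} [RCLike F] {k m n : ℕ} (hk : 0 < k) (hmn : n ≤ m)
    (A : Fin (k + 1) → Matrix (Fin m) (Fin n) F) :
    ∃ P : MvPolynomial ((Fin k) ⊕ ((Fin k × Fin m) × (Fin (k - 1) × Fin n))) F,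
      P ≠ 0 ∧
      ∀ (v : Fin k → F) (W : Matrix (Fin k × Fin m) (Fin (k - 1) × Fin n) F),
        MvPolynomial.eval (Sum.elim v fun e => W e.1 e.2) P ≠ 0 →
          FullZrank1 (L1Y A v W) v ∧
          IsStrongGLin A (pencil (L1X A v W) (L1Y A v W)) := by
  obtain ⟨K, rfl⟩ := Nat.exists_eq_succ_of_ne_zero hk.ne'
  refine ⟨genericPoly F K hmn, genericPoly_ne_zero hmn, fun v W hP => ?_⟩
  have he := eval_genericPoly hmn v W
  have h := mul_ne_zero_iff.1 fun h0 => hP (he.trans h0)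
  exact ⟨fullZrank1_of_isUnit hmn A h.1 (IsUnit.mk0 _ h.2),
    isGLin_pencil_of_isUnit hmn A h.1 (IsUnit.mk0 _ h.2),
    isGLin_revMat_pencil_of_isUnit hmn A h.1 (IsUnit.mk0 _ h.2)⟩
end GLin
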